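/- Conditional local martingale property after a stopping time (Corollary 'loc mg stroock varadhan'): Fix t* ≥ 0, a Borel probability measure P on Ω, and a finite (𝓕_t)-stopping time τ with τ ≥ t*. Let M = (M_s)_{s≥0} be a real-valued right-continuous (𝓕_t)-adapted process such that (M_s − M_{s∧t*})_{s≥0} is a local P-martingale with respect to (𝓕_t). Then there exists a P-null set N such that, for every ω ∉ N, the process (M_s − M_{s∧τ(ω)})_{s≥0} is a local martingale with respect to (𝓕_t) under the measure P(·|𝓕_τ)(ω). -/

import Mathlib

open MeasureTheory Set Filter Topology
open scoped NNReal ENNReal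

noncomputable section

namespace NLSP

/-- Lebesgue measure on `ℝ≥0`, obtained from Lebesgue measure on `ℝ`. -/
def leb : Measure ℝ≥0 := (volume : Measure ℝ).comap Subtype.val

section PathSpace

variable {F : Type*} [TopologicalSpace F]

/-- The shift map `θ_t ω = ω (· + t)` on the path space `C(ℝ≥0, F)`. -/
def theta (t : ℝ≥0) (ω : C(ℝ≥0, F)) : C(ℝ≥0, F) :=
  ω.comp ⟨fun s => s + t, by fun_prop⟩

/-- The map `γ_t ω = ω ((· - t)⁺)` on the path space `C(ℝ≥0, F)`. -/
def gammaShift (t : ℝ≥0) (ω : C(ℝ≥0, F)) : C(ℝ≥0, F) :=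
  ω.comp ⟨fun s => s - t, by fun_prop⟩

/-- The canonical σ-algebra `𝓕_t = σ(X_s : s ≤ t)` on the path space. -/
def canonicalSig (F : Type*) [TopologicalSpace F] (t : ℝ≥0) :
    MeasurableSpace C(ℝ≥0, F) :=
  ⨆ s ∈ Set.Iic t, MeasurableSpace.comap (fun ω : C(ℝ≥0, F) => ω s) (borel F)

/-- The right-continuous σ-algebra `𝒢^t_s = ⋂_{r > s} σ(X_{v+t} : v ≤ r)` generated by the
shifted coordinate process. -/
def shiftSig (F : Type*) [TopologicalSpace F] (t s : ℝ≥0) :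
    MeasurableSpace C(ℝ≥0, F) :=
  ⨅ r ∈ Set.Ioi s, ⨆ v ∈ Set.Iic r,
    MeasurableSpace.comap (fun ω : C(ℝ≥0, F) => ω (v + t)) (borel F)

end PathSpace

/-- A function `ℝ≥0 → E` is càdlàg if it is right-continuous and has left limits. -/
def Cadlag {E : Type*} [TopologicalSpace E] (f : ℝ≥0 → E) : Prop :=
  (∀ t, ContinuousWithinAt f (Set.Ici t) t) ∧
    ∀ t : ℝ≥0, 0 < t → ∃ l : E, Tendsto f (nhdsWithin t (Set.Iio t)) (nhds l)

/-- A function is upper semianalytic if its strict superlevel sets are analytic. -/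
def UpperSemianalytic {α : Type*} [TopologicalSpace α] (ψ : α → ℝ) : Prop :=
  ∀ c : ℝ, MeasureTheory.AnalyticSet {x | c < ψ x}

section Mart

variable {Ω' : Type*}

/-- `τ` is a stopping time for the filtration `𝒢`. -/
def IsStoppingTimeOn (𝒢 : ℝ≥0 → MeasurableSpace Ω') (τ : Ω' → ℝ≥0) : Prop :=
  ∀ t, MeasurableSet[𝒢 t] {ω | τ ω ≤ t}

/-- `N` is a `P`-martingale for the filtration `𝒢`. -/
def IsMartingaleOn [MeasurableSpace Ω'] (P : Measure Ω')
    (𝒢 : ℝ≥0 → MeasurableSpace Ω') {E : Type*} [NormedAddCommGroup E] [NormedSpace ℝ E]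
    (N : ℝ≥0 → Ω' → E) : Prop :=
  (∀ s, StronglyMeasurable[𝒢 s] (N s)) ∧ (∀ s, Integrable (N s) P) ∧
    ∀ s t : ℝ≥0, s ≤ t → ∀ A : Set Ω', MeasurableSet[𝒢 s] A →
      ∫ ω in A, N t ω ∂P = ∫ ω in A, N s ω ∂P

/-- `N` is a local `P`-martingale for the filtration `𝒢`: there is a localizing
nondecreasing sequence of `𝒢`-stopping times increasing `P`-a.s. to `∞` such that every
stopped process is a `P`-martingale. -/
def IsLocalMartingaleOn [MeasurableSpace Ω'] (P : Measure Ω')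
    (𝒢 : ℝ≥0 → MeasurableSpace Ω') {E : Type*} [NormedAddCommGroup E] [NormedSpace ℝ E]
    (N : ℝ≥0 → Ω' → E) : Prop :=
  ∃ σ : ℕ → Ω' → ℝ≥0,
    (∀ n, IsStoppingTimeOn 𝒢 (σ n)) ∧ (∀ n ω, σ n ω ≤ σ (n + 1) ω) ∧
      (∀ᵐ ω ∂P, Tendsto (fun n => σ n ω) atTop atTop) ∧
      ∀ n, IsMartingaleOn P 𝒢 fun s ω => N (min s (σ n ω)) ω

/-- Progressive measurability of `a` with respect to the filtration `𝒢`. -/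
def ProgMeasOn (𝒢 : ℝ≥0 → MeasurableSpace Ω') {E : Type*} [MeasurableSpace E]
    (a : ℝ≥0 → Ω' → E) : Prop :=
  ∀ s : ℝ≥0,
    @Measurable (ℝ≥0 × Ω') E ((inferInstance : MeasurableSpace ℝ≥0).prod (𝒢 s)) _
      fun p => a (min p.1 s) p.2

end Mart

section Main

variable {F : Type*} [TopologicalSpace F] {𝕂 : Type*} [RCLike 𝕂]
  [MeasurableSpace 𝕂] {U : Type*}

/-- The set `𝒞(t, ω)` of laws under which every test process `Y^u` is a special semimartingale
(after time `t`) with absolutely continuous compensator whose densities lie in `Θ`. -/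
def CSet [MeasurableSpace C(ℝ≥0, F)] (Y : U → ℝ≥0 → C(ℝ≥0, F) → 𝕂)
    (Θ : ℝ≥0 → C(ℝ≥0, F) → Set (U → 𝕂)) (t : ℝ≥0) (ω : C(ℝ≥0, F)) :
    Set (ProbabilityMeasure C(ℝ≥0, F)) :=
  {P | (P : Measure C(ℝ≥0, F)) {ω' | ∀ s ≤ t, ω' s = ω s} = 1 ∧
    ∃ a : U → ℝ≥0 → C(ℝ≥0, F) → 𝕂,
      (∀ u, ProgMeasOn (shiftSig F t) (a u)) ∧
      (∀ u, ∀ᵐ ω' ∂(P : Measure C(ℝ≥0, F)), ∀ s : ℝ≥0,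
        IntegrableOn (fun r => a u r ω') (Set.Iic s) leb) ∧
      (∀ u, IsLocalMartingaleOn (P : Measure C(ℝ≥0, F)) (shiftSig F t)
        fun s ω' => Y u (s + t) ω' - Y u t ω' - ∫ r in Set.Iic s, a u r ω' ∂leb) ∧
      ∀ᵐ p ∂(leb.prod (P : Measure C(ℝ≥0, F))),
        (fun u => a u p.1 p.2) ∈ Θ (p.1 + t) p.2}

/-- The set `ℛ(x) = 𝒞(0, x)` for the Markovian specification `Θ(t, ω) = Θ₀(ω t)`. -/
def RSet [MeasurableSpace C(ℝ≥0, F)] (Y : U → ℝ≥0 → C(ℝ≥0, F) → 𝕂)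
    (Θ₀ : F → Set (U → 𝕂)) (x : F) : Set (ProbabilityMeasure C(ℝ≥0, F)) :=
  CSet Y (fun s ω' => Θ₀ (ω' s)) 0 (ContinuousMap.const ℝ≥0 x)

/-- The set `𝒦(t, x)` for the Markovian specification `Θ(t, ω) = Θ₀(ω t)`. -/
def KSet [MeasurableSpace C(ℝ≥0, F)] (Y : U → ℝ≥0 → C(ℝ≥0, F) → 𝕂)
    (Θ₀ : F → Set (U → 𝕂)) (t : ℝ≥0) (x : F) : Set (ProbabilityMeasure C(ℝ≥0, F)) :=
  CSet Y (fun s ω' => Θ₀ (ω' s)) t (ContinuousMap.const ℝ≥0 x)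

end Main

end NLSP

namespace NLSP

section Conditioning

variable {F : Type*} [TopologicalSpace F]

open Classical in
/-- Concatenation `ω ⊗_t ω'` of two paths: if `ω'(t) = ω(t)` it follows `ω` until time `t`
and `ω'` afterwards; otherwise it is the stopped path `ω(· ∧ t)` (immaterial convention). -/
def concat (t : ℝ≥0) (ω ω' : C(ℝ≥0, F)) : C(ℝ≥0, F) :=
  if h : ω' t = ω t then
    ⟨fun s => if s ≤ t then ω s else ω' s,
      Continuous.if_le ω.continuous ω'.continuous continuous_id continuous_const
        fun s hs => by rw [hs, h]⟩
  else ω.comp ⟨fun s => min s t, by fun_prop⟩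

/-- The σ-algebra `𝓕_τ` of a stopping time `τ` (for a stopping time, the generating family
below is already a σ-algebra). -/
def ftau [MeasurableSpace C(ℝ≥0, F)] (τ : C(ℝ≥0, F) → ℝ≥0) :
    MeasurableSpace C(ℝ≥0, F) :=
  MeasurableSpace.generateFrom
    {A | MeasurableSet A ∧ ∀ t, MeasurableSet[canonicalSig F t] (A ∩ {ω | τ ω ≤ t})}

/-- `κ` is a regular conditional probability of `P` given `𝓕_τ`. -/
def IsRCP [MeasurableSpace C(ℝ≥0, F)] (P : Measure C(ℝ≥0, F)) (τ : C(ℝ≥0, F) → ℝ≥0)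
    (κ : C(ℝ≥0, F) → Measure C(ℝ≥0, F)) : Prop :=
  (∀ ω, IsProbabilityMeasure (κ ω)) ∧
    (∀ A : Set C(ℝ≥0, F), MeasurableSet A →
      @Measurable _ _ (ftau τ) _ fun ω => κ ω A) ∧
    ∀ A B : Set C(ℝ≥0, F), MeasurableSet A → MeasurableSet[ftau τ] B →
      P (A ∩ B) = ∫⁻ ω in B, κ ω A ∂P

/-- The pasting measure `P ⊗_τ Q`. -/
def pasting [MeasurableSpace C(ℝ≥0, F)] (P : Measure C(ℝ≥0, F)) (τ : C(ℝ≥0, F) → ℝ≥0)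
    (Q : C(ℝ≥0, F) → Measure C(ℝ≥0, F)) : Measure C(ℝ≥0, F) :=
  P.bind fun ω => (Q ω).map fun ω' => concat (τ ω) ω ω'

end Conditioning

end NLSP

namespace NLSP

section General

variable {Ω : Type*} [mΩ : MeasurableSpace Ω]

lemma det_aux (κ : Measure Ω) [IsProbabilityMeasure κ] (G : ℝ≥0 → MeasurableSpace Ω)
    (hmono : Monotone G) (hle : ∀ s, G s ≤ mΩ) (L : ℝ≥0 → Ω → ℝ)
    (had : ∀ s, StronglyMeasurable[G s] (L s))
    (hrc : ∀ ω s, ContinuousWithinAt (fun r => L r ω) (Set.Ici s) s)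
    (D : Set ℝ≥0) (hD : Dense D) (T : ℝ≥0) (hint : ∀ q ∈ D, Integrable (L q) κ)
    (hm : ∀ q ∈ D, ∀ q' ∈ D, T ≤ q → q ≤ q' → ∀ A, MeasurableSet[G q] A →
      ∫ ω in A, L q' ω ∂κ = ∫ ω in A, L q ω ∂κ)
    (s : ℝ≥0) (hs : T ≤ s) (q : ℝ≥0) (hq : q ∈ D) (hsq : s < q) :
    Integrable (L s) κ ∧ ∀ A, MeasurableSet[G s] A →
      ∫ ω in A, L q ω ∂κ = ∫ ω in A, L s ω ∂κ := by
  obtain ⟨u, -, hu, hut⟩ := hD.exists_seq_strictAnti_tendsto_of_lt hsq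
  have h1 : ∀ k, L (u k) =ᵐ[κ] κ[L q | G (u k)] := fun k =>
    ae_eq_condExp_of_forall_setIntegral_eq (hle _) (hint q hq)
      (fun A _ _ => (hint _ (hu k).2).integrableOn)
      (fun A hA _ => (hm _ (hu k).2 q hq (hs.trans (hu k).1.1.le) (hu k).1.2.le A hA).symm)
      (had _).aestronglyMeasurable
  have hUI : UniformIntegrable (fun k => L (u k)) 1 κ :=
    ((hint q hq).uniformIntegrable_condExp (fun k => hle (u k))).ae_eq fun k => (h1 k).symm
  have hlim : ∀ ω, Tendsto (fun k => L (u k) ω) atTop (𝓝 (L s ω)) := fun ω =>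
    (hrc ω s).tendsto.comp (tendsto_nhdsWithin_iff.2
      ⟨hut, Eventually.of_forall fun k => (hu k).1.1.le⟩)
  have hI : Integrable (L s) κ := hUI.integrable_of_ae_tendsto (ae_of_all _ hlim)
  refine ⟨hI, fun A hA => ?_⟩
  have h2 := tendsto_Lp_finite_of_tendsto_ae le_rfl ENNReal.one_ne_top hUI.1
    (memLp_one_iff_integrable.2 hI) hUI.2.1 (ae_of_all _ hlim)
  have h3 := tendsto_setIntegral_of_L1' (L s) hI.1
    (Eventually.of_forall fun k => hint _ (hu k).2) h2 A
  refine tendsto_nhds_unique (tendsto_const_nhds.congr fun k => ?_) h3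
  exact hm _ (hu k).2 q hq (hs.trans (hu k).1.1.le) (hu k).1.2.le A (hmono (hu k).1.1.le _ hA)

lemma det (κ : Measure Ω) [IsProbabilityMeasure κ] (G : ℝ≥0 → MeasurableSpace Ω)
    (hmono : Monotone G) (hle : ∀ s, G s ≤ mΩ) (L : ℝ≥0 → Ω → ℝ)
    (had : ∀ s, StronglyMeasurable[G s] (L s))
    (hrc : ∀ ω s, ContinuousWithinAt (fun r => L r ω) (Set.Ici s) s)
    (D : Set ℝ≥0) (hD : Dense D) (T : ℝ≥0) (hint : ∀ q ∈ D, Integrable (L q) κ)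
    (hm : ∀ q ∈ D, ∀ q' ∈ D, T ≤ q → q ≤ q' → ∀ A, MeasurableSet[G q] A →
      ∫ ω in A, L q' ω ∂κ = ∫ ω in A, L q ω ∂κ) :
    (∀ s, T ≤ s → Integrable (L s) κ) ∧ ∀ s t, T ≤ s → s ≤ t → ∀ A, MeasurableSet[G s] A →
      ∫ ω in A, L t ω ∂κ = ∫ ω in A, L s ω ∂κ := by
  have key := det_aux κ G hmono hle L had hrc D hD T hint hm
  constructor
  · intro s hs
    obtain ⟨q, hq, hsq⟩ := hD.exists_gt s
    exact (key s hs q hq hsq).1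
  · intro s t hs hst A hA
    obtain ⟨q, hq, hsq⟩ := hD.exists_gt t
    rw [← (key s hs q hq (hst.trans_lt hsq)).2 A hA,
      (key t (hs.trans hst) q hq hsq).2 A (hmono hst _ hA)]

lemma pi_ext (κ : Measure Ω) (m : MeasurableSpace Ω) (hm : m ≤ mΩ) (C : Set (Set Ω))
    (hC : IsPiSystem C) (hgen : m = MeasurableSpace.generateFrom C) (hu : Set.univ ∈ C)
    (f : Ω → ℝ) (hf : Integrable f κ) (h : ∀ A ∈ C, ∫ ω in A, f ω ∂κ = 0)
    (A : Set Ω) (hA : MeasurableSet[m] A) : ∫ ω in A, f ω ∂κ = 0 := by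
  induction A, hA using MeasurableSpace.induction_on_inter hgen hC with
  | empty => simp
  | basic A hA => exact h A hA
  | compl A hA ih =>
    have h1 := integral_add_compl (hm _ hA) hf
    have h2 := h _ hu
    rw [setIntegral_univ] at h2
    linarith
  | iUnion A hd hA ih =>
    rw [integral_iUnion (fun i => hm _ (hA i)) hd hf.integrableOn]
    simp [ih]

end General

section Cond

/-- abstract regular conditional probability -/
structure RCP {Ω : Type*} (m : MeasurableSpace Ω) [mΩ : MeasurableSpace Ω] (P : Measure Ω) (κ : Ω → Measure Ω) : Prop where
  le : m ≤ mΩ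
  prob : ∀ ω, IsProbabilityMeasure (κ ω)
  meas : ∀ A, MeasurableSet A → Measurable[m] fun ω => κ ω A
  eq : ∀ A B, MeasurableSet A → MeasurableSet[m] B → P (A ∩ B) = ∫⁻ ω in B, κ ω A ∂P

variable {Ω : Type*} {m : MeasurableSpace Ω} [mΩ : MeasurableSpace Ω]
  {P : Measure Ω} {κ : Ω → Measure Ω}

lemma RCP.ae_mem (h : RCP m P κ) {B : Set Ω} (hB : MeasurableSet[m] B) :
    ∀ᵐ ω ∂P, ω ∈ B → ∀ᵐ ω' ∂(κ ω), ω' ∈ B := by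
  have hB' := h.le _ hB
  have h1 := h.eq Bᶜ B hB'.compl hB
  rw [compl_inter_self, measure_empty] at h1
  have h2 := (lintegral_eq_zero_iff ((h.meas Bᶜ hB'.compl).mono h.le le_rfl)).1 h1.symm
  filter_upwards [(ae_restrict_iff' hB').1 h2] with ω hω hmem
  exact hω hmem

/-- The kernel -/
def RCP.ker (h : RCP m P κ) : ProbabilityTheory.Kernel Ω Ω :=
  ⟨κ, Measure.measurable_of_measurable_coe _ fun A hA => (h.meas A hA).mono h.le le_rfl⟩

/-- The kernel with respect to the small sigma-algebra. -/
def RCP.ker' (h : RCP m P κ) : @ProbabilityTheory.Kernel Ω Ω m mΩ :=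
  @ProbabilityTheory.Kernel.mk Ω Ω m mΩ κ
    (@Measure.measurable_of_measurable_coe Ω Ω mΩ m _ fun A hA => h.meas A hA)

lemma RCP.bind_eq (h : RCP m P κ) {B : Set Ω} (hB : MeasurableSet[m] B) :
    (P.restrict B).bind h.ker = P.restrict B := by
  ext A hA
  rw [Measure.bind_apply hA h.ker.aemeasurable, Measure.restrict_apply hA, h.eq A B hA hB]
  rfl

lemma RCP.bind_eq' (h : RCP m P κ) : P.bind h.ker = P := by
  have := h.bind_eq (B := Set.univ) MeasurableSet.univ
  rwa [Measure.restrict_univ] at this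

lemma RCP.ae_ae (h : RCP m P κ) {p : Ω → Prop} (hp : ∀ᵐ ω ∂P, p ω) :
    ∀ᵐ ω ∂P, ∀ᵐ ω' ∂(κ ω), p ω' := by
  rw [← h.bind_eq'] at hp
  exact Measure.ae_ae_of_ae_bind h.ker.aemeasurable hp

lemma RCP.ae_integrable (h : RCP m P κ) {f : Ω → ℝ} (hf : Integrable f P) :
    ∀ᵐ ω ∂P, Integrable f (κ ω) := by
  rw [← h.bind_eq'] at hf
  exact Measure.ae_integrable_of_integrable_comp hf

lemma RCP.integrable_integral (h : RCP m P κ) {f : Ω → ℝ} (hf : Integrable f P) :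
    Integrable (fun ω => ∫ x, f x ∂(κ ω)) P := by
  rw [← h.bind_eq', Measure.comp_eq_comp_const_apply] at hf
  exact hf.integral_comp

lemma RCP.setIntegral (h : RCP m P κ) {f : Ω → ℝ} (hf : Integrable f P)
    {B : Set Ω} (hB : MeasurableSet[m] B) :
    ∫ ω in B, ∫ x, f x ∂(κ ω) ∂P = ∫ ω in B, f ω ∂P := by
  have hf' : Integrable f (P.restrict B) := hf.restrict
  conv_rhs => rw [← h.bind_eq hB, Measure.comp_eq_comp_const_apply]
  rw [← h.bind_eq hB, Measure.comp_eq_comp_const_apply] at hf'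
  rw [ProbabilityTheory.Kernel.integral_comp hf']
  rfl

lemma RCP.ae_zero [IsProbabilityMeasure P] (h : RCP m P κ) {f : Ω → ℝ}
    (hfm : StronglyMeasurable f) (hf : Integrable f P)
    {C : Set Ω} (hC : MeasurableSet[m] C)
    (hz : ∀ B, MeasurableSet[m] B → ∫ ω in B ∩ C, f ω ∂P = 0) :
    ∀ᵐ ω ∂P, ω ∈ C → ∫ x, f x ∂(κ ω) = 0 := by
  have hsm : StronglyMeasurable[m] (fun ω => ∫ x, f x ∂(κ ω)) :=
    @StronglyMeasurable.integral_kernel Ω Ω m mΩ h.ker' ℝ _ _ f hfm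
  have hI := h.integrable_integral hf
  have : C.indicator (fun ω => ∫ x, f x ∂(κ ω)) =ᵐ[P] fun _ => 0 := by
    refine ae_eq_of_forall_setIntegral_eq_of_sigmaFinite' h.le
      (fun B _ _ => (hI.indicator (h.le _ hC)).integrableOn)
      (fun B _ _ => (integrable_zero _ _ _).integrableOn) (fun B hB _ => ?_)
      (hsm.indicator hC).aestronglyMeasurable stronglyMeasurable_const.aestronglyMeasurable
    rw [setIntegral_indicator (h.le _ hC), h.setIntegral hf (hB.inter hC), hz B hB]
    simp
  filter_upwards [this] with ω hω hmem
  rwa [Set.indicator_of_mem hmem] at hω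

end Cond

end NLSP
namespace NLSP

section Canon

variable {F : Type*} [TopologicalSpace F]

lemma canonicalSig_mono : Monotone (canonicalSig F) := by
  intro s t hst
  exact biSup_mono fun r hr => le_trans hr hst

lemma measurable_eval_canon {s t : ℝ≥0} (hst : s ≤ t) :
    @Measurable _ _ (canonicalSig F t) (borel F) (fun ω : C(ℝ≥0, F) => ω s) := by
  rw [measurable_iff_comap_le]
  exact le_iSup₂_of_le s hst le_rfl

lemma canonicalSig_le [m : MeasurableSpace C(ℝ≥0, F)] [BorelSpace C(ℝ≥0, F)] (t : ℝ≥0) :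
    canonicalSig F t ≤ m := by
  refine iSup₂_le fun s _ => ?_
  rw [← measurable_iff_comap_le]
  borelize F
  exact (continuous_eval_const s).measurable

/-- Sets that only depend on the path up to time `t`. -/
@[reducible]
def invSig (F : Type*) [TopologicalSpace F] (t : ℝ≥0) : MeasurableSpace C(ℝ≥0, F) where
  MeasurableSet' A := ∀ ω ω' : C(ℝ≥0, F), (∀ s ≤ t, ω' s = ω s) → (ω' ∈ A ↔ ω ∈ A)
  measurableSet_empty := by simp
  measurableSet_compl A hA ω ω' h := not_congr (hA ω ω' h)
  measurableSet_iUnion A hA ω ω' h := by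
    simp only [Set.mem_iUnion]
    exact exists_congr fun i => hA i ω ω' h

lemma canonicalSig_le_inv (t : ℝ≥0) : canonicalSig F t ≤ invSig F t := by
  refine iSup₂_le fun s hs => ?_
  rintro A ⟨B, -, rfl⟩ ω ω' h
  simp only [Set.mem_preimage]
  rw [h s hs]

lemma mem_iff_of_agree {t : ℝ≥0} {A : Set C(ℝ≥0, F)} (hA : MeasurableSet[canonicalSig F t] A)
    {ω ω' : C(ℝ≥0, F)} (h : ∀ s ≤ t, ω' s = ω s) : ω' ∈ A ↔ ω ∈ A :=
  canonicalSig_le_inv t A hA ω ω' h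

lemma eq_of_agree {t : ℝ≥0} {f : C(ℝ≥0, F) → ℝ} (hf : Measurable[canonicalSig F t] f)
    {ω ω' : C(ℝ≥0, F)} (h : ∀ s ≤ t, ω' s = ω s) : f ω' = f ω :=
  (mem_iff_of_agree (hf (measurableSet_singleton (f ω))) h).2 rfl

lemma canonicalSig_pi [PolishSpace F] (t : ℝ≥0) :
    ∃ C : Set (Set C(ℝ≥0, F)), C.Countable ∧ IsPiSystem C ∧ Set.univ ∈ C ∧
      canonicalSig F t = MeasurableSpace.generateFrom C := by
  borelize F
  have hcg : canonicalSig F t = ⨆ n : ℕ, MeasurableSpace.comap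
      (fun ω : C(ℝ≥0, F) => ω (min (TopologicalSpace.denseSeq ℝ≥0 n) t)) (borel F) := by
    apply le_antisymm
    · refine iSup₂_le fun s hs => ?_
      rw [← measurable_iff_comap_le]
      obtain ⟨u, hu, hut⟩ := mem_closure_iff_seq_limit.1
        ((TopologicalSpace.denseRange_denseSeq ℝ≥0) s)
      choose k hk using hu
      let _ : MeasurableSpace C(ℝ≥0, F) := ⨆ n : ℕ, MeasurableSpace.comap
        (fun ω : C(ℝ≥0, F) => ω (min (TopologicalSpace.denseSeq ℝ≥0 n) t)) (borel F)
      refine measurable_of_tendsto_metrizable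
        (f := fun i (ω : C(ℝ≥0, F)) => ω (min (u i) t)) (fun i => ?_) ?_
      · rw [measurable_iff_comap_le, ← hk i]
        exact le_iSup (fun n : ℕ => MeasurableSpace.comap
          (fun ω : C(ℝ≥0, F) => ω (min (TopologicalSpace.denseSeq ℝ≥0 n) t)) (borel F)) (k i)
      · rw [tendsto_pi_nhds]
        intro ω
        have h1 : Tendsto (fun i => min (u i) t) atTop (𝓝 (min s t)) :=
          hut.min tendsto_const_nhds
        rw [min_eq_left (Set.mem_Iic.1 hs)] at h1
        exact (ω.continuous.tendsto s).comp h1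
    · refine iSup_le fun n => ?_
      exact le_iSup₂_of_le (min (TopologicalSpace.denseSeq ℝ≥0 n) t)
        (Set.mem_Iic.2 (min_le_right _ _)) le_rfl
  obtain ⟨b, hbc, hb⟩ := (inferInstance :
    MeasurableSpace.CountablyGenerated F).isCountablyGenerated
  let S : Set (Set C(ℝ≥0, F)) := ⋃ n : ℕ,
    Set.preimage (fun ω : C(ℝ≥0, F) => ω (min (TopologicalSpace.denseSeq ℝ≥0 n) t)) '' b
  have hS : S.Countable := Set.countable_iUnion fun n => hbc.image _
  refine ⟨generateSetAlgebra S, countable_generateSetAlgebra hS, ?_,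
    isSetAlgebra_generateSetAlgebra.univ_mem, ?_⟩
  · intro A hA B hB _
    exact isSetAlgebra_generateSetAlgebra.inter_mem hA hB
  · rw [generateFrom_generateSetAlgebra_eq, hcg, ← MeasurableSpace.iSup_generateFrom]
    refine iSup_congr fun n => ?_
    rw [← MeasurableSpace.comap_generateFrom, ← hb]

variable [mC : MeasurableSpace C(ℝ≥0, F)]

lemma ftau_le (τ : C(ℝ≥0, F) → ℝ≥0) : ftau τ ≤ mC :=
  MeasurableSpace.generateFrom_le fun _ hA => hA.1

lemma ftau_inter {τ : C(ℝ≥0, F) → ℝ≥0} (hτ : IsStoppingTimeOn (canonicalSig F) τ)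
    {B : Set C(ℝ≥0, F)} (hB : MeasurableSet[ftau τ] B) (t : ℝ≥0) :
    MeasurableSet[canonicalSig F t] (B ∩ {ω | τ ω ≤ t}) := by
  induction B, hB using MeasurableSpace.generateFrom_induction with
  | hC A hA _ => exact hA.2 t
  | empty => rw [Set.empty_inter]; exact @MeasurableSet.empty _ (canonicalSig F t)
  | compl A _ ih =>
    have : Aᶜ ∩ {ω | τ ω ≤ t} = {ω | τ ω ≤ t} \ (A ∩ {ω | τ ω ≤ t}) := by
      ext x; simp; tauto
    rw [this]
    exact (hτ t).diff ih
  | iUnion A _ ih =>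
    rw [Set.iUnion_inter]
    exact MeasurableSet.iUnion ih

lemma ftau_of {τ : C(ℝ≥0, F) → ℝ≥0} [BorelSpace C(ℝ≥0, F)]
    {B : Set C(ℝ≥0, F)} (hB : MeasurableSet B)
    (h : ∀ t, MeasurableSet[canonicalSig F t] (B ∩ {ω | τ ω ≤ t})) : MeasurableSet[ftau τ] B :=
  MeasurableSpace.measurableSet_generateFrom ⟨hB, h⟩

lemma ftau_le_set {τ : C(ℝ≥0, F) → ℝ≥0} [BorelSpace C(ℝ≥0, F)]
    (hτ : IsStoppingTimeOn (canonicalSig F) τ) (s : ℝ≥0) :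
    MeasurableSet[ftau τ] {ω | τ ω ≤ s} := by
  refine ftau_of (canonicalSig_le s _ (hτ s)) fun t => ?_
  have : {ω | τ ω ≤ s} ∩ {ω | τ ω ≤ t} = {ω | τ ω ≤ min s t} := by
    ext x; simp
  rw [this]
  exact canonicalSig_mono (min_le_right s t) _ (hτ _)

lemma stop_lt {τ : C(ℝ≥0, F) → ℝ≥0} (hτ : IsStoppingTimeOn (canonicalSig F) τ) (q : ℝ≥0) :
    MeasurableSet[canonicalSig F q] {ω | q ≤ τ ω} := by
  have : {ω | q ≤ τ ω} = (⋃ n : ℕ, {ω | τ ω ≤ TopologicalSpace.denseSeq ℝ≥0 n ∧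
      TopologicalSpace.denseSeq ℝ≥0 n < q})ᶜ := by
    ext ω
    simp only [Set.mem_ofPred_eq, Set.mem_compl_iff, Set.mem_iUnion, not_exists, not_and, not_lt]
    constructor
    · exact fun h n hn => h.trans hn
    · intro h
      by_contra! hlt
      obtain ⟨_, ⟨n, rfl⟩, h1, h2⟩ :=
        (TopologicalSpace.denseRange_denseSeq ℝ≥0).exists_between hlt
      exact absurd (h n h1.le) (not_le.2 h2)
  rw [this]
  refine MeasurableSet.compl (MeasurableSet.iUnion fun n => ?_)
  by_cases hn : TopologicalSpace.denseSeq ℝ≥0 n < q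
  · simpa [hn] using canonicalSig_mono hn.le _ (hτ _)
  · simp [hn]

lemma ftau_eval {τ : C(ℝ≥0, F) → ℝ≥0} [BorelSpace C(ℝ≥0, F)]
    (hτ : IsStoppingTimeOn (canonicalSig F) τ) (q : ℝ≥0) {U : Set F} (hU : IsOpen U) :
    MeasurableSet[ftau τ] ({ω | q ≤ τ ω} ∩ {ω | ω q ∈ U}) := by
  have h1 : MeasurableSet[canonicalSig F q] ({ω | q ≤ τ ω} ∩ {ω | ω q ∈ U}) := by
    refine (stop_lt hτ q).inter ?_
    borelize F
    exact measurable_eval_canon le_rfl hU.measurableSet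
  refine ftau_of (canonicalSig_le q _ h1) fun t => ?_
  by_cases hqt : q ≤ t
  · exact (canonicalSig_mono hqt _ h1).inter (hτ t)
  · have : {ω | q ≤ τ ω} ∩ {ω | ω q ∈ U} ∩ {ω | τ ω ≤ t} = ∅ := by
      ext ω
      simp only [Set.mem_inter_iff, Set.mem_ofPred_eq, Set.mem_empty_iff_false, iff_false]
      rintro ⟨⟨h, -⟩, h'⟩
      exact hqt (h.trans h')
    rw [this]
    exact @MeasurableSet.empty _ (canonicalSig F t)

lemma agree_ae [PolishSpace F] [BorelSpace C(ℝ≥0, F)] {P : Measure C(ℝ≥0, F)}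
    {τ : C(ℝ≥0, F) → ℝ≥0}
    (hτ : IsStoppingTimeOn (canonicalSig F) τ) {κ : C(ℝ≥0, F) → Measure C(ℝ≥0, F)}
    (h : RCP (ftau τ) P κ) :
    ∀ᵐ ω ∂P, ∀ᵐ ω' ∂(κ ω), ∀ s ≤ τ ω, ω' s = ω s := by
  let D : Set ℝ≥0 := insert 0 (Set.range (TopologicalSpace.denseSeq ℝ≥0))
  have hDc : D.Countable := (Set.countable_range _).insert _
  have hDd : Dense D := (TopologicalSpace.denseRange_denseSeq ℝ≥0).mono (Set.subset_insert _ _)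
  have hb := TopologicalSpace.isBasis_countableBasis F
  have h1 : ∀ᵐ ω ∂P, ∀ q ∈ D, ∀ U ∈ TopologicalSpace.countableBasis F,
      ω ∈ ({ω | q ≤ τ ω} ∩ {ω | ω q ∈ U} : Set C(ℝ≥0, F)) →
      ∀ᵐ ω' ∂(κ ω), ω' ∈ ({ω | q ≤ τ ω} ∩ {ω | ω q ∈ U} : Set C(ℝ≥0, F)) := by
    rw [ae_ball_iff hDc]
    intro q _
    rw [ae_ball_iff (TopologicalSpace.countable_countableBasis F)]
    intro U hU
    exact h.ae_mem (ftau_eval hτ q (hb.isOpen hU))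
  filter_upwards [h1] with ω hω
  have h2 : ∀ᵐ ω' ∂(κ ω), ∀ q ∈ D, ∀ U ∈ TopologicalSpace.countableBasis F,
      q ≤ τ ω → ω q ∈ U → ω' q ∈ U := by
    rw [ae_ball_iff hDc]
    intro q hq
    rw [ae_ball_iff (TopologicalSpace.countable_countableBasis F)]
    intro U hU
    by_cases hc : q ≤ τ ω ∧ ω q ∈ U
    · filter_upwards [hω q hq U hU hc] with ω' h' _ _ using h'.2
    · exact ae_of_all _ fun ω' a b => absurd ⟨a, b⟩ hc
  filter_upwards [h2] with ω' h'
  have h3 : ∀ q ∈ D, q ≤ τ ω → ω' q = ω q := by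
    intro q hq hqτ
    by_contra hne
    obtain ⟨U, hU, hmem, hsub⟩ := hb.exists_subset_of_mem_open
      (show ω q ∈ ({ω' q}ᶜ : Set F) from fun e => hne e.symm) isOpen_compl_singleton
    exact hsub (h' q hq U hU hqτ hmem) rfl
  intro s hs
  rcases eq_or_ne (τ ω) 0 with h0 | h0
  · have : s = 0 := le_antisymm (hs.trans h0.le) zero_le
    subst this
    exact h3 0 (Set.mem_insert _ _) hs
  · have hcl : IsClosed {r : ℝ≥0 | ω' r = ω r} := isClosed_eq ω'.continuous ω.continuous
    have hsub : Set.Iio (τ ω) ∩ D ⊆ {r : ℝ≥0 | ω' r = ω r} := fun r hr => h3 r hr.2 hr.1.le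
    have h4 := hcl.closure_subset_iff.2 hsub
    have h5 : Set.Iic (τ ω) ⊆ closure (Set.Iio (τ ω) ∩ D) := by
      rw [← closure_Iio' ⟨0, pos_iff_ne_zero.2 h0⟩]
      exact closure_minimal (hDd.open_subset_closure_inter isOpen_Iio) isClosed_closure
    exact h4 (h5 hs)

end Canon

end NLSP
namespace NLSP

lemma step {F : Type*} [TopologicalSpace F] [PolishSpace F]
    [MeasurableSpace C(ℝ≥0, F)] [BorelSpace C(ℝ≥0, F)]
    {P : Measure C(ℝ≥0, F)} [IsProbabilityMeasure P]
    {τ : C(ℝ≥0, F) → ℝ≥0} (hτ : IsStoppingTimeOn (canonicalSig F) τ)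
    {κ : C(ℝ≥0, F) → Measure C(ℝ≥0, F)} (hR : RCP (ftau τ) P κ)
    {L : ℝ≥0 → C(ℝ≥0, F) → ℝ} (hL : IsMartingaleOn P (canonicalSig F) L)
    (hrc : ∀ ω s, ContinuousWithinAt (fun r => L r ω) (Set.Ici s) s) :
    ∀ᵐ ω ∂P, IsMartingaleOn (κ ω) (canonicalSig F)
      fun s ω' => L s ω' - L (min s (τ ω)) ω' := by
  obtain ⟨had, hLi, hLm⟩ := hL
  let D : Set ℝ≥0 := Set.range (TopologicalSpace.denseSeq ℝ≥0)
  have hDc : D.Countable := Set.countable_range _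
  have hDd : Dense D := TopologicalSpace.denseRange_denseSeq ℝ≥0
  choose C hCc hCpi hCu hCgen using fun q => canonicalSig_pi (F := F) q
  have hCm : ∀ q, ∀ A ∈ C q, MeasurableSet[canonicalSig F q] A := by
    intro q A hA
    rw [hCgen q]
    exact MeasurableSpace.measurableSet_generateFrom hA
  have h1 : ∀ᵐ ω ∂P, ∀ q ∈ D, Integrable (L q) (κ ω) := by
    rw [ae_ball_iff hDc]
    exact fun q _ => hR.ae_integrable (hLi q)
  have h2 : ∀ᵐ ω ∂P, ∀ q ∈ D, ∀ q' ∈ D, ∀ A ∈ C q, q ≤ q' → τ ω ≤ q →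
      ∫ x, A.indicator (fun x => L q' x - L q x) x ∂(κ ω) = 0 := by
    rw [ae_ball_iff hDc]
    intro q _
    rw [ae_ball_iff hDc]
    intro q' _
    rw [ae_ball_iff (hCc q)]
    intro A hA
    by_cases hqq : q ≤ q'
    swap
    · exact ae_of_all _ fun ω h => absurd h hqq
    have hAm := hCm q A hA
    have hAm' := canonicalSig_le q _ hAm
    have := hR.ae_zero (f := A.indicator (fun x => L q' x - L q x)) (C := {ω | τ ω ≤ q})
      ((((had q').mono (canonicalSig_le q')).sub ((had q).mono (canonicalSig_le q))).indicator hAm')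
      (((hLi q').sub (hLi q)).indicator hAm') (ftau_le_set hτ q) (fun B hB => by
        rw [setIntegral_indicator hAm',
          integral_sub (hLi q').integrableOn (hLi q).integrableOn, sub_eq_zero]
        exact hLm q q' hqq _ ((ftau_inter hτ hB q).inter hAm))
    filter_upwards [this] with ω hω _ using hω
  filter_upwards [h1, h2, agree_ae hτ hR] with ω hω1 hω2 hag
  have := hR.prob ω
  obtain ⟨hI, hE⟩ := det (κ ω) (canonicalSig F) canonicalSig_mono canonicalSig_le L had hrc D hDd
    (τ ω) hω1 (by
      intro q hq q' hq' hTq hqq A hA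
      rw [← sub_eq_zero, ← integral_sub (hω1 q' hq').integrableOn (hω1 q hq).integrableOn]
      refine pi_ext (κ ω) (canonicalSig F q) (canonicalSig_le q) (C q) (hCpi q) (hCgen q) (hCu q)
        (fun x => L q' x - L q x) ((hω1 q' hq').sub (hω1 q hq)) (fun A hA => ?_) A hA
      rw [← integral_indicator (canonicalSig_le q _ (hCm q A hA))]
      exact hω2 q hq q' hq' A hA hqq hTq)
  have hIall : ∀ s, Integrable (L s) (κ ω) := by
    intro s
    rcases le_total (τ ω) s with h | h
    · exact hI s h
    · refine (integrable_const (L s ω)).congr ?_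
      filter_upwards [hag] with ω' h'
      exact (eq_of_agree (had s).measurable fun r hr => h' r (hr.trans h)).symm
  refine ⟨fun s => (had s).sub ((had _).mono (canonicalSig_mono (min_le_left _ _))),
    fun s => (hIall s).sub (hIall _), fun s t hst A hA => ?_⟩
  rcases le_total t (τ ω) with ht | ht
  · simp [min_eq_left ht, min_eq_left (hst.trans ht)]
  rcases le_total (τ ω) s with hs | hs
  · beta_reduce
    rw [min_eq_right ht, min_eq_right hs,
      integral_sub (hIall _).integrableOn (hIall _).integrableOn,
      integral_sub (hIall _).integrableOn (hIall _).integrableOn, hE s t hs hst A hA]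
  · beta_reduce
    rw [min_eq_right ht, min_eq_left hs,
      integral_sub (hIall _).integrableOn (hIall _).integrableOn,
      hE (τ ω) t le_rfl ht A (canonicalSig_mono hs _ hA)]
    simp


/-- **Conditional local martingale property after a stopping time**: if `(M_s − M_{s ∧ t*})` is
a local `P`-martingale and `τ ≥ t*` is a finite stopping time, then there is a `P`-null set `N`
such that for every `ω ∉ N` the process `(M_s − M_{s ∧ τ(ω)})` is a local martingale under
(any version of) the regular conditional probability `P(·|𝓕_τ)(ω)`. -/
theorem conditional_local_martingale_after_stopping_time
    {F : Type*} [TopologicalSpace F] [PolishSpace F]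
    [MeasurableSpace C(ℝ≥0, F)] [BorelSpace C(ℝ≥0, F)]
    (P : Measure C(ℝ≥0, F)) [IsProbabilityMeasure P]
    (tstar : ℝ≥0)
    (τ : C(ℝ≥0, F) → ℝ≥0) (hτ : IsStoppingTimeOn (canonicalSig F) τ)
    (hτt : ∀ ω, tstar ≤ τ ω)
    (M : ℝ≥0 → C(ℝ≥0, F) → ℝ)
    (hMadapted : ∀ s, Measurable[canonicalSig F s] (M s))
    (hMrc : ∀ ω : C(ℝ≥0, F), ∀ s : ℝ≥0,
      ContinuousWithinAt (fun r => M r ω) (Set.Ici s) s)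
    (hmart : IsLocalMartingaleOn P (canonicalSig F) fun s ω => M s ω - M (min s tstar) ω)
    (κ : C(ℝ≥0, F) → Measure C(ℝ≥0, F)) (hκ : IsRCP P τ κ) :
    ∃ N : Set C(ℝ≥0, F), MeasurableSet N ∧ P N = 0 ∧
      ∀ ω ∉ N, IsLocalMartingaleOn (κ ω) (canonicalSig F)
        fun s ω' => M s ω' - M (min s (τ ω)) ω' := by
  have hR : RCP (ftau τ) P κ := ⟨ftau_le τ, hκ.1, hκ.2.1, hκ.2.2⟩
  obtain ⟨σ, hσ, hσm, hσt, hσM⟩ := hmart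
  have hall : ∀ᵐ ω ∂P, IsLocalMartingaleOn (κ ω) (canonicalSig F)
        fun s ω' => M s ω' - M (min s (τ ω)) ω' := by
    have h1 : ∀ᵐ ω ∂P, ∀ n, IsMartingaleOn (κ ω) (canonicalSig F) fun s ω' =>
        (M (min s (σ n ω')) ω' - M (min (min s (σ n ω')) tstar) ω') -
        (M (min (min s (τ ω)) (σ n ω')) ω' - M (min (min (min s (τ ω)) (σ n ω')) tstar) ω') := by
      rw [ae_all_iff]
      intro n
      refine step hτ hR (L := fun s ω' =>
        M (min s (σ n ω')) ω' - M (min (min s (σ n ω')) tstar) ω') (hσM n) fun ω s => ?_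
      have e1 : ContinuousWithinAt (fun r => M (min r (σ n ω)) ω) (Set.Ici s) s :=
        (hMrc ω (min s (σ n ω))).comp
          (f := fun r : ℝ≥0 => min r (σ n ω)) (by fun_prop)
          (fun r hr => Set.mem_Ici.2 (min_le_min_right _ (Set.mem_Ici.1 hr)))
      have e2 : ContinuousWithinAt (fun r => M (min (min r (σ n ω)) tstar) ω) (Set.Ici s) s :=
        (hMrc ω (min (min s (σ n ω)) tstar)).comp
          (f := fun r : ℝ≥0 => min (min r (σ n ω)) tstar) (by fun_prop)
          (fun r hr => Set.mem_Ici.2 (min_le_min_right _ (min_le_min_right _ (Set.mem_Ici.1 hr))))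
      exact e1.sub e2
    filter_upwards [h1, hR.ae_ae hσt] with ω hω1 hω2
    refine ⟨σ, hσ, hσm, hω2, fun n => ?_⟩
    convert hω1 n using 3 with s ω'
    have e1 : min (min s (τ ω)) (σ n ω') = min (min s (σ n ω')) (τ ω) := min_right_comm _ _ _
    have e2 : min (min (min s (σ n ω')) (τ ω)) tstar = min (min s (σ n ω')) tstar := by
      rw [min_assoc, min_eq_right (hτt ω)]
    rw [e1, e2]
    ring
  obtain ⟨N, hN, hNm, hN0⟩ := exists_measurable_superset_of_null (ae_iff.1 hall)
  refine ⟨N, hNm, hN0, fun ω hω => ?_⟩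
  by_contra hc
  exact hω (hN hc)

end NLSP
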